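/- Define B⁺ on the monoid F_ℓ(X) by sending a word F to the single-tree word graft(F). Then F_ℓ(X) with B⁺ is the free operated monoid on X: for every monoid S, every function Q : S → S, and every function f : X → S, there exists a unique monoid homomorphism φ : F_ℓ(X) → S such that φ(B⁺(F)) = Q(φ(F)) for every F ∈ F_ℓ(X) and φ(•_x) = f(x) for every x ∈ X. -/

import Mathlib

inductive LTree (X : Type*) : Type _
  | leaf : X → LTree X
  | graft : List (LTree X) → LTree X

abbrev LForest (X : Type*) := FreeMonoid (LTree X)

/-- The grafting operation on leaf-decorated forests (at the level of the free monoid). -/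
def BpM {X : Type*} (F : LForest X) : LForest X :=
  FreeMonoid.of (LTree.graft (FreeMonoid.toList F))

mutual

/-- Evaluation of a leaf-decorated tree in an operated monoid. -/
def LTree.eval {X S : Type*} [Monoid S] (Q : S → S) (f : X → S) : LTree X → S
  | .leaf x => f x
  | .graft F => Q (LTree.evalList Q f F)

/-- The ordered product of the evaluations of the trees of a forest. -/
def LTree.evalList {X S : Type*} [Monoid S] (Q : S → S) (f : X → S) : List (LTree X) → S
  | [] => 1
  | t :: F => LTree.eval Q f t * LTree.evalList Q f F

end

theorem LTree.evalList_eq_lift {X S : Type*} [Monoid S] (Q : S → S) (f : X → S)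
    (F : List (LTree X)) :
    LTree.evalList Q f F = FreeMonoid.lift (LTree.eval Q f) (FreeMonoid.ofList F) := by
  induction F with
  | nil => simp [LTree.evalList]
  | cons t F ih => simp [LTree.evalList, ih, FreeMonoid.ofList_cons]

mutual

theorem LTree.hom_of_eq_eval {X S : Type*} [Monoid S] {Q : S → S} {f : X → S}
    (φ : LForest X →* S) (hQ : ∀ F : LForest X, φ (BpM F) = Q (φ F))
    (hf : ∀ x : X, φ (FreeMonoid.of (LTree.leaf x)) = f x) :
    ∀ t : LTree X, φ (FreeMonoid.of t) = LTree.eval Q f t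
  | .leaf x => by rw [hf, LTree.eval]
  | .graft F => by
    rw [LTree.eval, ← LTree.hom_ofList_eq_evalList φ hQ hf F, ← hQ]
    rfl

theorem LTree.hom_ofList_eq_evalList {X S : Type*} [Monoid S] {Q : S → S} {f : X → S}
    (φ : LForest X →* S) (hQ : ∀ F : LForest X, φ (BpM F) = Q (φ F))
    (hf : ∀ x : X, φ (FreeMonoid.of (LTree.leaf x)) = f x) :
    ∀ F : List (LTree X), φ (FreeMonoid.ofList F) = LTree.evalList Q f F
  | [] => by rw [LTree.evalList, FreeMonoid.ofList_nil, map_one]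
  | t :: F => by
    rw [LTree.evalList, FreeMonoid.ofList_cons, map_mul, LTree.hom_of_eq_eval φ hQ hf t,
      LTree.hom_ofList_eq_evalList φ hQ hf F]

end

theorem leafForests_free_operated_monoid (X : Type*) (S : Type*) [Monoid S]
    (Q : S → S) (f : X → S) :
    ∃! φ : LForest X →* S,
      (∀ F : LForest X, φ (BpM F) = Q (φ F)) ∧
      (∀ x : X, φ (FreeMonoid.of (LTree.leaf x)) = f x) := by
  refine ⟨FreeMonoid.lift (LTree.eval Q f), ⟨fun F => ?_, fun x => ?_⟩, fun φ ⟨hQ, hf⟩ => ?_⟩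
  · rw [BpM, FreeMonoid.lift_eval_of, LTree.eval, LTree.evalList_eq_lift, FreeMonoid.ofList_toList]
  · rw [FreeMonoid.lift_eval_of, LTree.eval]
  · refine FreeMonoid.hom_eq fun t => ?_
    rw [FreeMonoid.lift_eval_of, LTree.hom_of_eq_eval φ hQ hf]
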